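/- arXiv:2207.00441 — 2 statements merged into one kernel-verified Lean document; each statement's English description precedes it below -/
import Mathlib

section
/- (Grönwall-type inequality, Lemma 2.9) Let T > 0, T₁ ∈ [0,T], p ≥ 1, q ≥ 1, and α₀ > 0. Suppose y : [0,T] → ℝ is absolutely continuous on [0,T] with y(0) = y₀ and integrable derivative y', and suppose there are measurable functions α, g : [0,T] → ℝ with α(t) ≥ α₀ for every t ∈ [0,T], with (∫₀^{T₁} |g(s)|^p ds)^{1/p} < ∞ and (∫_{T₁}^{T} |g(s)|^q ds)^{1/q} < ∞, and such that y'(t) + α(t) y(t) ≤ g(t) for almost every t ∈ [0,T]. Then sup_{0 ≤ t ≤ T} y(t) ≤ |y₀| + (1 + α₀⁻¹) · ( (∫₀^{T₁} |g(s)|^p ds)^{1/p} + (∫_{T₁}^{T} |g(s)|^q ds)^{1/q} ). -/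
open MeasureTheory Set

/-- Differential Grönwall inequality with constant damping `a`, for absolutely continuous
functions. -/
theorem AbsolutelyContinuousOnInterval.le_exp_mul_add_integral {F h : ℝ → ℝ} {a s t : ℝ}
    (hst : s ≤ t) (hF : AbsolutelyContinuousOnInterval F s t)
    (hh : IntervalIntegrable h volume s t)
    (hle : ∀ᵐ x, x ∈ Ioc s t → deriv F x + a * F x ≤ h x) :
    F t ≤ Real.exp (a * (s - t)) * F s + ∫ x in s..t, Real.exp (a * (x - t)) * h x := by
  set w : ℝ → ℝ := fun x => Real.exp (a * (x - t)) with hw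
  have hwc : Continuous w := by fun_prop
  have hwd : ∀ x, HasDerivAt w (w x * a) x := fun x => by
    simpa using (((hasDerivAt_id x).sub_const t).const_mul a).exp
  have hwAC : AbsolutelyContinuousOnInterval w s t :=
    ContDiffOn.absolutelyContinuousOnInterval (by fun_prop)
  have key := hwAC.integral_deriv_mul_eq_sub hF
  have hwt : w t = 1 := by simp [hw]
  have hmono : ∫ x in s..t, deriv w x * F x + w x * deriv F x ≤ ∫ x in s..t, w x * h x := by
    refine intervalIntegral.integral_mono_ae_restrict hst
      ((hwAC.intervalIntegrable_deriv.mul_continuousOn hF.continuousOn).add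
        (hF.intervalIntegrable_deriv.continuousOn_mul hwAC.continuousOn))
      (hh.continuousOn_mul hwc.continuousOn) ?_
    rw [← Measure.restrict_congr_set Ioc_ae_eq_Icc]
    refine (ae_restrict_iff' measurableSet_Ioc).2 ?_
    filter_upwards [hle] with x hx hxst
    rw [(hwd x).deriv]
    nlinarith [mul_le_mul_of_nonneg_left (hx hxst) (Real.exp_pos (a * (x - t))).le]
  rw [key, hwt] at hmono
  linarith

/-- A Hölder-type estimate against a weight with values in `[0, 1]`, whose constant does not
depend on the exponent. -/
theorem MeasureTheory.integral_mul_le_one_add_mul_rpow_integral {X : Type*} [MeasurableSpace X]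
    {μ : Measure X} {w f : X → ℝ} {C p : ℝ} (hp : 1 ≤ p)
    (hw : Integrable w μ) (hw0 : 0 ≤ᵐ[μ] w) (hw1 : w ≤ᵐ[μ] 1) (hwC : ∫ x, w x ∂μ ≤ C)
    (hf0 : 0 ≤ f) (hf : Integrable (fun x => f x ^ p) μ) :
    ∫ x, w x * f x ∂μ ≤ (1 + C) * (∫ x, f x ^ p ∂μ) ^ (1 / p) := by
  have hp0 : 0 < p := by linarith
  have hfp0 : ∀ x, 0 ≤ f x ^ p := fun x => Real.rpow_nonneg (hf0 x) p
  have hI : 0 ≤ ∫ x, f x ^ p ∂μ := integral_nonneg hfp0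
  rcases hI.eq_or_lt with h0 | hpos
  · have hz : (fun x => f x ^ p) =ᵐ[μ] 0 := (integral_eq_zero_iff_of_nonneg hfp0 hf).1 h0.symm
    have hwf : ∫ x, w x * f x ∂μ = 0 := by
      refine integral_eq_zero_of_ae ?_
      filter_upwards [hz] with x hx
      simp [(Real.rpow_eq_zero (hf0 x) hp0.ne').1 hx]
    rw [hwf, ← h0, Real.zero_rpow (one_div_pos.2 hp0).ne', mul_zero]
  · set N : ℝ := (∫ x, f x ^ p ∂μ) ^ (1 / p) with hN
    have hNpos : 0 < N := Real.rpow_pos_of_pos hpos _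
    have hNp : N ^ p = ∫ x, f x ^ p ∂μ := by
      rw [hN, ← Real.rpow_mul hI, one_div_mul_cancel hp0.ne', Real.rpow_one]
    have hint : Integrable (fun x => N * (w x + f x ^ p / N ^ p)) μ :=
      (hw.add (hf.div_const _)).const_mul N
    have hle : ∫ x, w x * f x ∂μ ≤ ∫ x, N * (w x + f x ^ p / N ^ p) ∂μ := by
      refine integral_mono_of_nonneg ?_ hint ?_
      · filter_upwards [hw0] with x hx using mul_nonneg hx (hf0 x)
      · filter_upwards [hw0, hw1] with x hx0 hx1
        have hx0' : 0 ≤ w x := hx0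
        have hx1' : w x ≤ 1 := hx1
        obtain ⟨z, hz⟩ : ∃ z, z = f x / N := ⟨_, rfl⟩
        have hz0 : 0 ≤ z := hz ▸ div_nonneg (hf0 x) hNpos.le
        have hfz : f x = N * z := by rw [hz]; field_simp
        have hzp : f x ^ p / N ^ p = z ^ p := by rw [hz, Real.div_rpow (hf0 x) hNpos.le]
        have hzp0 : 0 ≤ z ^ p := Real.rpow_nonneg hz0 p
        have hwz : w x * z ≤ w x + z ^ p := by
          rcases le_total z 1 with h1 | h1
          · nlinarith
          · have := Real.self_le_rpow_of_one_le h1 hp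
            nlinarith
        show w x * f x ≤ N * (w x + f x ^ p / N ^ p)
        rw [hzp, hfz, mul_left_comm]
        exact mul_le_mul_of_nonneg_left hwz hNpos.le
    have heq : ∫ x, N * (w x + f x ^ p / N ^ p) ∂μ = N * (∫ x, w x ∂μ + 1) := by
      rw [integral_const_mul, integral_add hw (hf.div_const _), integral_div, hNp,
        div_self hpos.ne']
    rw [heq] at hle
    nlinarith

theorem MeasureTheory.IntegrableOn.of_abs_rpow {g : ℝ → ℝ} {S : Set ℝ} {p : ℝ} (hp : 1 ≤ p)
    (hS : volume S ≠ ⊤) (hg : Measurable g) (hgp : IntegrableOn (fun s => |g s| ^ p) S) :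
    IntegrableOn (fun s => |g s|) S := by
  have h1 : IntegrableOn (fun _ : ℝ => (1 : ℝ)) S := integrableOn_const hS
  refine (h1.add hgp).mono' hg.abs.aestronglyMeasurable (ae_of_all _ fun x => ?_)
  have h0 : 0 ≤ |g x| := abs_nonneg _
  have hp0 : 0 ≤ |g x| ^ p := Real.rpow_nonneg h0 p
  simp only [Pi.add_apply, Real.norm_eq_abs, abs_abs]
  rcases le_total (|g x|) 1 with h | h
  · linarith
  · linarith [Real.self_le_rpow_of_one_le h hp]

theorem setIntegral_exp_mul_abs_le {g : ℝ → ℝ} {S : Set ℝ} {a t p : ℝ} (ha : 0 < a)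
    (hp : 1 ≤ p) (hS : MeasurableSet S) (hgp : IntegrableOn (fun s => |g s| ^ p) S) :
    ∫ s in S ∩ Iic t, Real.exp (a * (s - t)) * |g s| ≤
      (1 + a⁻¹) * (∫ s in S, |g s| ^ p) ^ (1 / p) := by
  have hexp : ∀ s, Real.exp (a * (s - t)) = Real.exp (a * s) * Real.exp (-(a * t)) := fun s => by
    rw [← Real.exp_add]; ring_nf
  have hwi : IntegrableOn (fun s => Real.exp (a * (s - t))) (Iic t) := by
    simp only [hexp]
    exact (integrableOn_exp_mul_Iic ha t).mul_const _
  have hwI : ∫ s in Iic t, Real.exp (a * (s - t)) = a⁻¹ := by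
    simp only [hexp]
    rw [integral_mul_const, integral_exp_mul_Iic ha, div_mul_eq_mul_div, ← Real.exp_add]
    simp
  have hw0 : ∀ s, 0 ≤ Real.exp (a * (s - t)) := fun s => (Real.exp_pos _).le
  refine (integral_mul_le_one_add_mul_rpow_integral (C := a⁻¹) hp (hwi.mono_set inter_subset_right)
    (ae_of_all _ hw0) ?_ ?_ (fun s => abs_nonneg (g s)) (hgp.mono_set inter_subset_left)).trans ?_
  · refine (ae_restrict_iff' (hS.inter measurableSet_Iic)).2 (ae_of_all _ fun s hs => ?_)
    exact Real.exp_le_one_iff.2 (mul_nonpos_of_nonneg_of_nonpos ha.le (sub_nonpos.2 hs.2))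
  · rw [← hwI]
    exact setIntegral_mono_set hwi (ae_of_all _ hw0) inter_subset_right.eventuallyLE
  · have hnn : ∀ s, 0 ≤ |g s| ^ p := fun s => Real.rpow_nonneg (abs_nonneg _) p
    refine mul_le_mul_of_nonneg_left (Real.rpow_le_rpow (integral_nonneg hnn) ?_ ?_) ?_
    · exact setIntegral_mono_set hgp (ae_of_all _ hnn) inter_subset_left.eventuallyLE
    · positivity
    · positivity

/-- Grönwall-type inequality (Lemma 2.9 of the paper): if `y` is absolutely
continuous on `[0,T]` (so that `y t = y₀ + ∫₀ᵗ y'`) with integrable derivative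
`y'`, and `y' + α y ≤ g` a.e. on `[0,T]` with `α ≥ α₀ > 0`, then
`sup_{[0,T]} y ≤ |y₀| + (1 + α₀⁻¹)(‖g‖_{L^p(0,T₁)} + ‖g‖_{L^q(T₁,T)})`. -/
theorem gronwall_type_inequality
    (T T₁ p q α₀ y₀ : ℝ) (hT : 0 < T) (hT₁ : T₁ ∈ Icc 0 T)
    (hp : 1 ≤ p) (hq : 1 ≤ q) (hα₀ : 0 < α₀)
    (y y' α g : ℝ → ℝ)
    (hy0 : y 0 = y₀)
    (hy'int : IntegrableOn y' (Icc 0 T))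
    (hyAC : ∀ t ∈ Icc 0 T, y t = y₀ + ∫ s in (0:ℝ)..t, y' s)
    (hα : Measurable α) (hg : Measurable g)
    (hαlb : ∀ t ∈ Icc 0 T, α₀ ≤ α t)
    (hgp : IntegrableOn (fun s => |g s| ^ p) (Ioc 0 T₁))
    (hgq : IntegrableOn (fun s => |g s| ^ q) (Ioc T₁ T))
    (hode : ∀ᵐ t ∂(volume.restrict (Icc 0 T)), y' t + α t * y t ≤ g t) :
    ∀ t ∈ Icc 0 T,
      y t ≤ |y₀| + (1 + α₀⁻¹) *
        ((∫ s in Ioc 0 T₁, |g s| ^ p) ^ (1 / p) +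
         (∫ s in Ioc T₁ T, |g s| ^ q) ^ (1 / q)) := by
  intro t ht
  have hT1 := hT₁.1
  have hT2 := hT₁.2
  have hg1 := hgp.of_abs_rpow hp (by simp) hg
  have hg2 := hgq.of_abs_rpow hq (by simp) hg
  have hgi : IntegrableOn (fun s => |g s|) (Ioc 0 T) := by
    rw [← Ioc_union_Ioc_eq_Ioc hT1 hT2]
    exact hg1.union hg2
  set w : ℝ → ℝ := fun s => Real.exp (α₀ * (s - t)) with hw
  have hwc : Continuous w := by fun_prop
  have hw0 : ∀ s, 0 ≤ w s := fun s => (Real.exp_pos _).le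
  have hwg0 : ∀ s, 0 ≤ w s * |g s| := fun s => mul_nonneg (hw0 s) (abs_nonneg _)
  have hwg : IntegrableOn (fun s => w s * |g s|) (Ioc 0 T) :=
    (((integrableOn_Icc_iff_integrableOn_Ioc (by simp)).2 hgi).continuousOn_mul hwc.continuousOn
      isCompact_Icc).mono_set Ioc_subset_Icc_self
  have hforce : ∫ s in Ioc 0 T ∩ Iic t, w s * |g s| ≤ (1 + α₀⁻¹) *
      ((∫ s in Ioc 0 T₁, |g s| ^ p) ^ (1 / p) + (∫ s in Ioc T₁ T, |g s| ^ q) ^ (1 / q)) := by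
    rw [← Ioc_union_Ioc_eq_Ioc hT1 hT2] at hwg ⊢
    rw [union_inter_distrib_right, setIntegral_union
      ((Ioc_disjoint_Ioc_of_le le_rfl).mono inter_subset_left inter_subset_left)
      (measurableSet_Ioc.inter measurableSet_Iic)
      (hwg.left_of_union.mono_set inter_subset_left)
      (hwg.right_of_union.mono_set inter_subset_left), mul_add]
    exact add_le_add (setIntegral_exp_mul_abs_le hα₀ hp measurableSet_Ioc hgp)
      (setIntegral_exp_mul_abs_le hα₀ hq measurableSet_Ioc hgq)
  refine le_trans ?_ (add_le_add_right hforce |y₀|)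
  set F : ℝ → ℝ := fun x => y₀ + ∫ s in (0:ℝ)..x, y' s with hFdef
  have hy'I : IntervalIntegrable y' volume 0 T :=
    (intervalIntegrable_iff_integrableOn_Icc_of_le hT.le).2 hy'int
  have hFAC : AbsolutelyContinuousOnInterval F 0 T :=
    (contDiffOn_const.absolutelyContinuousOnInterval).fun_add
      (hy'I.absolutelyContinuousOnInterval_intervalIntegral left_mem_uIcc)
  have hFc : ContinuousOn F (Icc 0 t) := by
    have := hFAC.continuousOn
    rw [uIcc_of_le hT.le] at this
    exact this.mono (Icc_subset_Icc_right ht.2)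
  obtain ⟨r, ⟨hr, hrle⟩, hrmax⟩ : ∃ r, IsGreatest (Icc 0 t ∩ F ⁻¹' Iic |y₀|) r := by
    refine (isCompact_Icc.of_isClosed_subset
      (hFc.preimage_isClosed_of_isClosed isClosed_Icc isClosed_Iic)
      inter_subset_left).exists_isGreatest ⟨0, ⟨le_rfl, ht.1⟩, ?_⟩
    simpa [hFdef] using le_abs_self y₀
  have hrt : r ≤ t := hr.2
  have hsub : Ioc r t ⊆ Ioc 0 T := Ioc_subset_Ioc hr.1 ht.2
  have hdamp : ∀ᵐ x, x ∈ Ioc r t → deriv F x + α₀ * F x ≤ |g x| := by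
    filter_upwards [(ae_restrict_iff' measurableSet_Icc).1 hode, hy'I.ae_hasDerivAt_integral]
      with x hx hxd hxr
    have hxT : x ∈ Icc 0 T := Ioc_subset_Icc_self (hsub hxr)
    have hd : deriv F x = y' x :=
      ((hxd (by rwa [uIcc_of_le hT.le]) 0 left_mem_uIcc).const_add y₀).deriv
    have hxpos : 0 ≤ F x := by
      by_contra! hneg
      have : x ≤ r := hrmax ⟨⟨hr.1.trans hxr.1.le, hxr.2⟩, hneg.le.trans (abs_nonneg y₀)⟩
      exact absurd hxr.1 this.not_gt
    have hyF : y x = F x := hyAC x hxT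
    have hode' := hx hxT
    rw [hyF] at hode'
    rw [hd]
    nlinarith [mul_le_mul_of_nonneg_right (hαlb x hxT) hxpos, le_abs_self (g x)]
  have hmain := AbsolutelyContinuousOnInterval.le_exp_mul_add_integral hrt
    (hFAC.mono (by
      rw [uIcc_of_le hrt, uIcc_of_le hT.le]
      exact Icc_subset_Icc hr.1 ht.2))
    ((intervalIntegrable_iff_integrableOn_Ioc_of_le hrt).2 (hgi.mono_set hsub)) hdamp
  have hinit : Real.exp (α₀ * (r - t)) * F r ≤ |y₀| := by
    have h1 : Real.exp (α₀ * (r - t)) ≤ 1 := Real.exp_le_one_iff.2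
      (mul_nonpos_of_nonneg_of_nonpos hα₀.le (sub_nonpos.2 hrt))
    calc Real.exp (α₀ * (r - t)) * F r ≤ Real.exp (α₀ * (r - t)) * |y₀| := by gcongr; exact hrle
      _ ≤ |y₀| := mul_le_of_le_one_left (abs_nonneg _) h1
  have htail : ∫ x in r..t, w x * |g x| ≤ ∫ s in Ioc 0 T ∩ Iic t, w s * |g s| := by
    rw [intervalIntegral.integral_of_le hrt]
    exact setIntegral_mono_set (hwg.mono_set inter_subset_left) (ae_of_all _ hwg0)
      (LE.le.eventuallyLE fun x hx => ⟨hsub hx, hx.2⟩)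
  rw [hyAC t ht]
  exact hmain.trans (add_le_add hinit htail)
end

section
/- For every real θ > 0, one has θ − log θ − 1 ≥ (1/8)·(θ − 1)·1_{(θ > 2)} + (1/12)·(θ − 1)²·1_{(θ < 3)}, where 1_{(θ>2)} equals 1 if θ > 2 and 0 otherwise, and 1_{(θ<3)} equals 1 if θ < 3 and 0 otherwise. (When 2 < θ < 3 both terms are present.) -/
/-- A quadratic lower bound for `x - log x - 1` on a bounded interval, from
`log x = 2 * log √x ≤ 2 * (√x - 1)`. -/
lemma sub_one_sq_div_twelve_le_sub_log_sub_one {x : ℝ} (hx : 0 < x) (hx4 : x ≤ 4) :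
    (x - 1) ^ 2 / 12 ≤ x - Real.log x - 1 := by
  obtain ⟨s, hs, rfl⟩ : ∃ s : ℝ, 0 < s ∧ x = s ^ 2 :=
    ⟨√x, Real.sqrt_pos.2 hx, (Real.sq_sqrt hx.le).symm⟩
  have hs2 : s ≤ 2 := by nlinarith
  have hlog : Real.log (s ^ 2) ≤ 2 * (s - 1) := by
    rw [Real.log_pow]
    push_cast
    linarith [Real.log_le_sub_one_of_pos hs]
  have hfac : 0 ≤ (s - 1) ^ 2 * (12 - (s + 1) ^ 2) :=
    mul_nonneg (sq_nonneg _) (by nlinarith)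
  nlinarith

/-- The tangent line bound for `log` at `2`, with a rational constant. -/
lemma log_le_half_sub {x : ℝ} (hx : 0 < x) : Real.log x ≤ x / 2 - 3 / 10 := by
  have h := Real.log_le_sub_one_of_pos (half_pos hx)
  rw [Real.log_div hx.ne' two_ne_zero] at h
  linarith [Real.log_two_lt_d9]

/-- Pointwise splitting of the thermal entropy: for every `θ > 0`,
`θ − log θ − 1 ≥ (1/8)(θ − 1)·1_{θ>2} + (1/12)(θ − 1)²·1_{θ<3}`. -/
theorem thermal_integrand_split_bound (θ : ℝ) (hθ : 0 < θ) :
    (1 / 8) * (θ - 1) * (if 2 < θ then (1:ℝ) else 0) +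
      (1 / 12) * (θ - 1) ^ 2 * (if θ < 3 then (1:ℝ) else 0) ≤
        θ - Real.log θ - 1 := by
  have hlog := log_le_half_sub hθ
  split_ifs with h2 h3 h3
  · nlinarith [mul_pos (sub_pos.2 h2) (sub_pos.2 h3)]
  · linarith
  · linarith [sub_one_sq_div_twelve_le_sub_log_sub_one hθ (by linarith)]
  · linarith
end
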